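/- There exists a constant C₃ depending only on n with the following property. Let R > 0, M ≥ 0, and let u ≥ 0 be continuous on the parabolic cylinder B_R, of class C² in x and C¹ in t in the interior, satisfying |∂ₜu − Δu| ≤ M in B_R. Then for every r with 0 < r ≤ R, one has u(x,t)/r + |∇ₓu(x,t)| ≤ C₃·( u(0,0)/r + M·r ) for all (x,t) ∈ A_r. -/

import Mathlib

open Set

/-- Second partial derivative of `f` in the `i`-th coordinate direction. -/
noncomputable def secondPartial {n : ℕ} (f : EuclideanSpace ℝ (Fin n) → ℝ)
    (x : EuclideanSpace ℝ (Fin n)) (i : Fin n) : ℝ :=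
  fderiv ℝ (fun y => fderiv ℝ f y (EuclideanSpace.single i 1)) x (EuclideanSpace.single i 1)

/-- Laplacian in the space variables of `u = u(x,t)`. -/
noncomputable def spatialLaplacian {n : ℕ} (u : EuclideanSpace ℝ (Fin n) → ℝ → ℝ)
    (x : EuclideanSpace ℝ (Fin n)) (t : ℝ) : ℝ :=
  ∑ i, secondPartial (fun z => u z t) x i

open Filter Topology

/-- The symmetric second derivative of `f` at `x` along `v` exists and equals `a`. -/
def HasSymmSecondDeriv {E : Type*} [AddCommGroup E] [Module ℝ E] (f : E → ℝ) (x v : E) (a : ℝ) :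
    Prop :=
  Tendsto (fun s : ℝ => (f (x + s • v) + f (x - s • v) - 2 * f x) / s ^ 2) (𝓝[≠] 0) (𝓝 a)

/-- The heat operator `∂ₜ - Δ`, in the sense of a time derivative and symmetric second derivatives
along the coordinate directions, is defined on `u` at `(x, t)` and takes the value `c`. -/
def HasHeatValue {n : ℕ} (u : EuclideanSpace ℝ (Fin n) → ℝ → ℝ) (x : EuclideanSpace ℝ (Fin n))
    (t c : ℝ) : Prop :=
  ∃ (a : ℝ) (b : Fin n → ℝ), HasDerivAt (fun s => u x s) a t ∧
    (∀ i, HasSymmSecondDeriv (fun z => u z t) x (EuclideanSpace.single i 1) (b i)) ∧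
    a - ∑ i, b i = c

namespace HasSymmSecondDeriv

variable {E : Type*} [AddCommGroup E] [Module ℝ E] {f g : E → ℝ} {x v : E} {a b : ℝ}

lemma sub (hf : HasSymmSecondDeriv f x v a) (hg : HasSymmSecondDeriv g x v b) :
    HasSymmSecondDeriv (fun z => f z - g z) x v (a - b) := by
  refine (Tendsto.sub hf hg).congr fun s => ?_
  ring

lemma const_mul (c : ℝ) (hf : HasSymmSecondDeriv f x v a) :
    HasSymmSecondDeriv (fun z => c * f z) x v (c * a) := by
  refine (Tendsto.const_mul c hf).congr fun s => ?_
  ring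

lemma of_eq_add (c : ℝ)
    (h : ∀ s : ℝ, f (x + s • v) + f (x - s • v) - 2 * f x = a * s ^ 2 + c * s ^ 4) :
    HasSymmSecondDeriv f x v a := by
  have h1 : Tendsto (fun s : ℝ => a + c * s ^ 2) (𝓝[≠] 0) (𝓝 a) := by
    have : Tendsto (fun s : ℝ => a + c * s ^ 2) (𝓝 0) (𝓝 (a + c * 0 ^ 2)) :=
      Continuous.tendsto (by fun_prop) _
    simpa using this.mono_left nhdsWithin_le_nhds
  refine h1.congr' ?_
  filter_upwards [self_mem_nhdsWithin] with s hs
  have hs : s ≠ 0 := hs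
  rw [h]
  field_simp

lemma nonpos_of_eventually_le (hf : HasSymmSecondDeriv f x v a)
    (h : ∀ᶠ s : ℝ in 𝓝 0, f (x + s • v) ≤ f x) : a ≤ 0 := by
  refine le_of_tendsto hf ?_
  have h2 : ∀ᶠ s : ℝ in 𝓝 0, f (x + (-s) • v) ≤ f x := by
    have : Tendsto (fun s : ℝ => -s) (𝓝 0) (𝓝 0) := by
      simpa using (continuous_neg (G := ℝ)).tendsto 0
    exact this.eventually h
  filter_upwards [nhdsWithin_le_nhds h, nhdsWithin_le_nhds h2] with s h1 h2
  rw [neg_smul, ← sub_eq_add_neg] at h2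
  exact div_nonpos_of_nonpos_of_nonneg (by linarith) (sq_nonneg s)

/-- L'Hôpital: two derivatives along a line give the symmetric second derivative. -/
lemma of_hasDerivAt {f' : ℝ → ℝ}
    (h1 : ∀ᶠ s : ℝ in 𝓝 0, HasDerivAt (fun s : ℝ => f (x + s • v)) (f' s) s)
    (h2 : HasDerivAt f' a 0) : HasSymmSecondDeriv f x v a := by
  have hneg : Tendsto (fun s : ℝ => -s) (𝓝 0) (𝓝 0) := by
    simpa using (continuous_neg (G := ℝ)).tendsto 0
  have h1' := hneg.eventually h1
  have hc0 : ContinuousAt (fun s : ℝ => f (x + s • v)) 0 := h1.self_of_nhds.continuousAt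
  have hc : Tendsto (fun s : ℝ => f (x + s • v)) (𝓝 0) (𝓝 (f x)) := by
    have := hc0.tendsto
    simpa using this
  have key : Tendsto (fun s : ℝ => (f' s - f' (-s)) / (2 * s)) (𝓝[≠] 0) (𝓝 a) := by
    have hd : HasDerivAt (fun s : ℝ => f' s - f' (-s)) (2 * a) 0 := by
      have h3 : HasDerivAt f' a (-0) := by simpa using h2
      have h4 := h3.comp (0 : ℝ) (hasDerivAt_neg (0 : ℝ))
      exact (h2.sub h4).congr_deriv (by ring)
    have h6 := hd.tendsto_slope_zero.const_mul (1 / 2)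
    refine (h6.congr fun s => ?_).trans (by simp)
    simp
    ring
  refine HasDerivAt.lhopital_zero_nhdsNE (f := fun s => f (x + s • v) + f (x - s • v) - 2 * f x)
    (g := fun s => s ^ 2) (f' := fun s => f' s - f' (-s)) (g' := fun s => 2 * s)
    ?_ ?_ ?_ ?_ ?_ key
  · filter_upwards [nhdsWithin_le_nhds h1, nhdsWithin_le_nhds h1'] with s hs hs'
    have h3 := hs'.comp s (hasDerivAt_neg s)
    have h4 := ((hs.add h3).sub_const (2 * f x)).congr_deriv
      (show f' s + f' (-s) * -1 = f' s - f' (-s) by ring)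
    refine h4.congr_of_eventuallyEq (Eventually.of_forall fun y => ?_)
    simp [sub_eq_add_neg]
  · exact Eventually.of_forall fun s => by simpa using hasDerivAt_pow 2 s
  · filter_upwards [self_mem_nhdsWithin] with s hs
    exact mul_ne_zero two_ne_zero hs
  · have h3 := (hc.add (hc.comp hneg)).sub_const (2 * f x)
    have h4 : f x + f x - 2 * f x = 0 := by ring
    rw [h4] at h3
    refine (h3.mono_left nhdsWithin_le_nhds).congr fun s => ?_
    simp [sub_eq_add_neg]
  · have : Tendsto (fun s : ℝ => s ^ 2) (𝓝 0) (𝓝 (0 ^ 2)) := Continuous.tendsto (by fun_prop) _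
    simpa using this.mono_left nhdsWithin_le_nhds

end HasSymmSecondDeriv

namespace HasHeatValue

variable {n : ℕ} {u v : EuclideanSpace ℝ (Fin n) → ℝ → ℝ} {x : EuclideanSpace ℝ (Fin n)}
  {t c d : ℝ}

lemma sub (hu : HasHeatValue u x t c) (hv : HasHeatValue v x t d) :
    HasHeatValue (fun z s => u z s - v z s) x t (c - d) := by
  obtain ⟨a, b, h1, h2, rfl⟩ := hu
  obtain ⟨a', b', h1', h2', rfl⟩ := hv
  refine ⟨a - a', fun i => b i - b' i, h1.sub h1', fun i => (h2 i).sub (h2' i), ?_⟩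
  rw [Finset.sum_sub_distrib]
  ring

lemma const_mul (k : ℝ) (hu : HasHeatValue u x t c) :
    HasHeatValue (fun z s => k * u z s) x t (k * c) := by
  obtain ⟨a, b, h1, h2, rfl⟩ := hu
  refine ⟨k * a, fun i => k * b i, h1.const_mul k, fun i => (h2 i).const_mul k, ?_⟩
  rw [← Finset.mul_sum]
  ring

lemma neg (hu : HasHeatValue u x t c) : HasHeatValue (fun z s => -u z s) x t (-c) := by
  simpa using hu.const_mul (-1)

lemma add (hu : HasHeatValue u x t c) (hv : HasHeatValue v x t d) :
    HasHeatValue (fun z s => u z s + v z s) x t (c + d) := by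
  simpa using hu.sub hv.neg

lemma time (t₀ : ℝ) : HasHeatValue (fun _ s => s - t₀) x t 1 := by
  refine ⟨1, fun _ => 0, (hasDerivAt_id t).sub_const t₀, fun i => ?_, by simp⟩
  exact .of_eq_add 0 fun s => by ring

lemma coord (i : Fin n) (k : ℝ) : HasHeatValue (fun z _ => z i - k) x t 0 := by
  refine ⟨0, fun _ => 0, hasDerivAt_const _ _, fun j => ?_, by simp⟩
  exact .of_eq_add 0 fun s => by simp; ring

lemma coord_sq (i : Fin n) (k : ℝ) : HasHeatValue (fun z _ => (z i - k) ^ 2) x t (-2) := by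
  refine ⟨0, fun j => 2 * (if i = j then 1 else 0), hasDerivAt_const _ _, fun j => ?_, ?_⟩
  · refine .of_eq_add 0 fun s => ?_
    by_cases h : i = j
    · subst h; simp; ring
    · simp [h]; ring
  · rw [← Finset.mul_sum]; simp

lemma norm_sub_sq (y : EuclideanSpace ℝ (Fin n)) :
    HasHeatValue (fun z _ => ‖z - y‖ ^ 2) x t (-(2 * n)) := by
  refine ⟨0, fun j => 2, hasDerivAt_const _ _, fun j => ?_, ?_⟩
  · refine .of_eq_add 0 fun s => ?_
    have e1 : x + s • EuclideanSpace.single j (1 : ℝ) - y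
      = (x - y) + s • EuclideanSpace.single j (1 : ℝ) := by abel
    have e2 : x - s • EuclideanSpace.single j (1 : ℝ) - y
      = (x - y) - s • EuclideanSpace.single j (1 : ℝ) := by abel
    simp only [e1, e2]
    generalize x - y = w
    rw [norm_add_sq_real, norm_sub_sq_real, norm_smul]
    simp
    ring
  · simp; ring

end HasHeatValue

/-- Weak maximum principle on a compact set. -/
lemma nonpos_of_hasHeatValue_neg {n : ℕ} {F : EuclideanSpace ℝ (Fin n) → ℝ → ℝ}
    {K : Set (EuclideanSpace ℝ (Fin n) × ℝ)} (hK : IsCompact K)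
    (hF : ContinuousOn (fun p : EuclideanSpace ℝ (Fin n) × ℝ => F p.1 p.2) K)
    (h : ∀ x t, (x, t) ∈ K → F x t ≤ 0 ∨
      ((∃ c < 0, HasHeatValue F x t c) ∧ (∀ᶠ s in 𝓝[<] t, (x, s) ∈ K) ∧
        ∀ i, ∀ᶠ s : ℝ in 𝓝 0, (x + s • EuclideanSpace.single i (1 : ℝ), t) ∈ K))
    {x : EuclideanSpace ℝ (Fin n)} {t : ℝ} (hx : (x, t) ∈ K) : F x t ≤ 0 := by
  obtain ⟨⟨y, s⟩, hy, hmax⟩ := hK.exists_isMaxOn ⟨_, hx⟩ hF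
  have hmax' : ∀ z τ, (z, τ) ∈ K → F z τ ≤ F y s := fun z τ hz => hmax hz
  refine (hmax' x t hx).trans ?_
  rcases h y s hy with h0 | ⟨⟨c, hc, a, b, hd, hb, rfl⟩, ht, hi⟩
  · exact h0
  exfalso
  have ha : 0 ≤ a := by
    have h1 : Tendsto (slope (fun s => F y s) s) (𝓝[<] s) (𝓝 a) :=
      (hasDerivAt_iff_tendsto_slope.1 hd).mono_left (nhdsWithin_mono _ fun z hz => ne_of_lt hz)
    refine ge_of_tendsto h1 ?_
    filter_upwards [ht, self_mem_nhdsWithin] with τ h1 h2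
    have h2 : τ < s := h2
    rw [slope_def_field]
    exact div_nonneg_of_nonpos (by linarith [hmax' _ _ h1]) (by linarith)
  have hb' : ∑ i, b i ≤ 0 := Finset.sum_nonpos fun i _ =>
    (hb i).nonpos_of_eventually_le ((hi i).mono fun τ hτ => hmax' _ _ hτ)
  linarith

/-- The closed backward parabolic cylinder with vertex `(x₀, t₀)` and radius `d`. -/
def backwardCylinder {n : ℕ} (x₀ : EuclideanSpace ℝ (Fin n)) (t₀ d : ℝ) :
    Set (EuclideanSpace ℝ (Fin n) × ℝ) :=
  Metric.closedBall x₀ d ×ˢ Icc (t₀ - d ^ 2) t₀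

lemma mem_backwardCylinder {n : ℕ} {x₀ x : EuclideanSpace ℝ (Fin n)} {t₀ d t : ℝ} :
    (x, t) ∈ backwardCylinder x₀ t₀ d ↔ ‖x - x₀‖ ≤ d ∧ t₀ - d ^ 2 ≤ t ∧ t ≤ t₀ := by
  simp [backwardCylinder, dist_eq_norm]

lemma isCompact_backwardCylinder {n : ℕ} (x₀ : EuclideanSpace ℝ (Fin n)) (t₀ d : ℝ) :
    IsCompact (backwardCylinder x₀ t₀ d) :=
  (isCompact_closedBall x₀ d).prod isCompact_Icc

lemma abs_coord_le_norm {n : ℕ} (x : EuclideanSpace ℝ (Fin n)) (i : Fin n) : |x i| ≤ ‖x‖ := by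
  simpa using PiLp.norm_apply_le x i

/-- Boundary estimate for a subsolution vanishing on a hyperplane through the centre. -/
lemma le_of_nonpos_on_hyperplane {n : ℕ} {v : EuclideanSpace ℝ (Fin n) → ℝ → ℝ}
    {x₀ : EuclideanSpace ℝ (Fin n)} {t₀ d N A M : ℝ} (i : Fin n) (hd : 0 < d) (hN : 0 ≤ N)
    (hA : 2 * M + (2 * n + 1) * (N / d ^ 2) < 2 * A) (hA0 : 0 ≤ A)
    (hcont : ContinuousOn (fun p : EuclideanSpace ℝ (Fin n) × ℝ => v p.1 p.2)
      (backwardCylinder x₀ t₀ d))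
    (hle : ∀ x t, (x, t) ∈ backwardCylinder x₀ t₀ d → v x t ≤ N)
    (hzero : ∀ x t, x i = x₀ i → v x t ≤ 0)
    (heq : ∀ x t, (x, t) ∈ backwardCylinder x₀ t₀ d → t₀ - d ^ 2 < t →
      ∃ c ≤ 2 * M, HasHeatValue v x t c)
    {x : EuclideanSpace ℝ (Fin n)} (hx : ‖x - x₀‖ ≤ d) (hxi : x₀ i ≤ x i) :
    v x t₀ ≤ N / d ^ 2 * ‖x - x₀‖ ^ 2 + A * (2 * d * (x i - x₀ i) - (x i - x₀ i) ^ 2) := by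
  have hd2 : 0 < d ^ 2 := by positivity
  have hNd : 0 ≤ N / d ^ 2 := by positivity
  have hNd' : N / d ^ 2 * d ^ 2 = N := by field_simp
  set K := backwardCylinder x₀ t₀ d ∩ {p | x₀ i ≤ p.1 i} with hK
  have hclosed : IsClosed {p : EuclideanSpace ℝ (Fin n) × ℝ | x₀ i ≤ p.1 i} :=
    isClosed_le continuous_const (by fun_prop)
  have hKc : IsCompact K := (isCompact_backwardCylinder x₀ t₀ d).inter_right hclosed
  have key := nonpos_of_hasHeatValue_neg (F := fun z s => v z s -
      (N / d ^ 2 * (‖z - x₀‖ ^ 2 - (s - t₀)) +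
        A * (2 * d * (z i - x₀ i) - (z i - x₀ i) ^ 2))) (x := x) (t := t₀) hKc ?_ ?_ ?_
  · simp only [sub_self, sub_zero] at key
    linarith
  · refine (hcont.mono inter_subset_left).sub (Continuous.continuousOn ?_)
    fun_prop
  · intro y s hys
    obtain ⟨hyc, hyi⟩ := hys
    have hyi : x₀ i ≤ y i := hyi
    have hyc' := mem_backwardCylinder.1 hyc
    have hz : y i - x₀ i ≤ d := by
      have := abs_coord_le_norm (y - x₀) i
      exact (le_abs_self _).trans (by simpa using this.trans hyc'.1)
    have hzz : 0 ≤ A * (2 * d * (y i - x₀ i) - (y i - x₀ i) ^ 2) :=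
      mul_nonneg hA0 (by nlinarith)
    rcases hyi.eq_or_lt with h0 | h0
    · left
      have h1 := hzero y s h0.symm
      have : 0 ≤ N / d ^ 2 * (‖y - x₀‖ ^ 2 - (s - t₀)) :=
        mul_nonneg hNd (by nlinarith [sq_nonneg ‖y - x₀‖])
      linarith
    have hb : d ^ 2 ≤ ‖y - x₀‖ ^ 2 - (s - t₀) → v y s -
      (N / d ^ 2 * (‖y - x₀‖ ^ 2 - (s - t₀)) +
        A * (2 * d * (y i - x₀ i) - (y i - x₀ i) ^ 2)) ≤ 0 := by
      intro h
      have h1 := hle y s hyc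
      have := mul_le_mul_of_nonneg_left h hNd
      linarith
    rcases hyc'.1.eq_or_lt with h1 | h1
    · left
      exact hb (by rw [h1]; linarith)
    rcases hyc'.2.1.eq_or_lt with h2 | h2
    · left
      exact hb (by nlinarith [sq_nonneg ‖y - x₀‖])
    right
    refine ⟨?_, ?_, ?_⟩
    · obtain ⟨c, hc, hv⟩ := heq y s hyc h2
      refine ⟨_, ?_, hv.sub ((((HasHeatValue.norm_sub_sq x₀).sub
        (HasHeatValue.time t₀)).const_mul (N / d ^ 2)).add
        ((((HasHeatValue.coord i (x₀ i)).const_mul (2 * d)).sub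
          (HasHeatValue.coord_sq i (x₀ i))).const_mul A))⟩
      linarith
    · filter_upwards [Ioo_mem_nhdsLT h2] with τ hτ
      exact ⟨mem_backwardCylinder.2 ⟨hyc'.1, hτ.1.le, hτ.2.le.trans hyc'.2.2⟩, hyi⟩
    · intro j
      have c1 : Continuous fun s : ℝ => y + s • EuclideanSpace.single j (1 : ℝ) := by fun_prop
      have c2 : Continuous fun s : ℝ => (y + s • EuclideanSpace.single j (1 : ℝ)) i := by fun_prop
      have e1 : ∀ᶠ s : ℝ in 𝓝 0, ‖y + s • EuclideanSpace.single j (1 : ℝ) - x₀‖ < d := by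
        refine (c1.sub continuous_const).norm.tendsto 0 |>.eventually_lt_const ?_
        simpa using h1
      have e2 : ∀ᶠ s : ℝ in 𝓝 0, x₀ i < (y + s • EuclideanSpace.single j (1 : ℝ)) i := by
        refine c2.tendsto 0 |>.eventually_const_lt ?_
        simpa using h0
      filter_upwards [e1, e2] with τ h3 h4
      exact ⟨mem_backwardCylinder.2 ⟨h3.le, hyc'.2⟩, h4.le⟩
  · exact ⟨mem_backwardCylinder.2 ⟨hx, by linarith, le_rfl⟩, hxi⟩

/-- Reflection in the hyperplane through `x₀` orthogonal to the `i`-th coordinate direction. -/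
noncomputable def coordReflection {n : ℕ} (x₀ : EuclideanSpace ℝ (Fin n)) (i : Fin n)
    (x : EuclideanSpace ℝ (Fin n)) : EuclideanSpace ℝ (Fin n) :=
  x - (2 * (x i - x₀ i)) • EuclideanSpace.single i (1 : ℝ)

lemma norm_coordReflection_sub {n : ℕ} (x₀ : EuclideanSpace ℝ (Fin n)) (i : Fin n)
    (x : EuclideanSpace ℝ (Fin n)) : ‖coordReflection x₀ i x - x₀‖ = ‖x - x₀‖ := by
  have h : coordReflection x₀ i x - x₀
      = (x - x₀) - (2 * (x - x₀) i) • EuclideanSpace.single i (1 : ℝ) := by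
    simp only [coordReflection, PiLp.sub_apply]
    abel
  rw [h]
  generalize x - x₀ = w
  have h2 : ‖w - (2 * w i) • EuclideanSpace.single i (1 : ℝ)‖ ^ 2 = ‖w‖ ^ 2 := by
    rw [norm_sub_sq_real, norm_smul, inner_smul_right]
    simp [mul_pow, EuclideanSpace.inner_single_right]
    ring
  exact (sq_eq_sq₀ (norm_nonneg _) (norm_nonneg _)).1 h2

lemma HasHeatValue.comp_coordReflection {n : ℕ} {u : EuclideanSpace ℝ (Fin n) → ℝ → ℝ}
    {x₀ x : EuclideanSpace ℝ (Fin n)} {i : Fin n} {t c : ℝ}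
    (h : HasHeatValue u (coordReflection x₀ i x) t c) :
    HasHeatValue (fun z s => u (coordReflection x₀ i z) s) x t c := by
  obtain ⟨a, b, h1, h2, h3⟩ := h
  refine ⟨a, b, h1, fun j => ?_, h3⟩
  refine (h2 j).congr fun s => ?_
  by_cases hij : i = j
  · subst hij
    have e1 : coordReflection x₀ i (x + s • EuclideanSpace.single i (1 : ℝ))
        = coordReflection x₀ i x - s • EuclideanSpace.single i (1 : ℝ) := by
      ext k; by_cases hk : k = i <;> simp [coordReflection, hk]; ring
    have e2 : coordReflection x₀ i (x - s • EuclideanSpace.single i (1 : ℝ))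
        = coordReflection x₀ i x + s • EuclideanSpace.single i (1 : ℝ) := by
      ext k; by_cases hk : k = i <;> simp [coordReflection, hk]; ring
    simp only [e1, e2]
    ring
  · have e1 : coordReflection x₀ i (x + s • EuclideanSpace.single j (1 : ℝ))
        = coordReflection x₀ i x + s • EuclideanSpace.single j (1 : ℝ) := by
      simp [coordReflection, hij]; abel
    have e2 : coordReflection x₀ i (x - s • EuclideanSpace.single j (1 : ℝ))
        = coordReflection x₀ i x - s • EuclideanSpace.single j (1 : ℝ) := by
      simp [coordReflection, hij]; abel
    simp only [e1, e2]

/-- Interior gradient estimate for `|∂ₜu - Δu| ≤ M`. -/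
lemma norm_fderiv_le_of_hasHeatValue {n : ℕ} {u : EuclideanSpace ℝ (Fin n) → ℝ → ℝ}
    {x₀ : EuclideanSpace ℝ (Fin n)} {t₀ d N M : ℝ} (hd : 0 < d) (hM : 0 ≤ M)
    (hcont : ContinuousOn (fun p : EuclideanSpace ℝ (Fin n) × ℝ => u p.1 p.2)
      (backwardCylinder x₀ t₀ d))
    (hu : ∀ x t, (x, t) ∈ backwardCylinder x₀ t₀ d → 0 ≤ u x t ∧ u x t ≤ N)
    (heq : ∀ x t, (x, t) ∈ backwardCylinder x₀ t₀ d → t₀ - d ^ 2 < t →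
      ∃ c, |c| ≤ M ∧ HasHeatValue u x t c)
    (hdiff : DifferentiableAt ℝ (fun z => u z t₀) x₀) :
    ‖fderiv ℝ (fun z => u z t₀) x₀‖ ≤ n * (M * d + (n + 1) * N / d) := by
  have hmem₀ : (x₀, t₀) ∈ backwardCylinder x₀ t₀ d :=
    mem_backwardCylinder.2 ⟨by simpa using hd.le, by nlinarith, le_rfl⟩
  have hN : 0 ≤ N := (hu _ _ hmem₀).1.trans (hu _ _ hmem₀).2
  have hrefl : ∀ i x t, (x, t) ∈ backwardCylinder x₀ t₀ d →
      (coordReflection x₀ i x, t) ∈ backwardCylinder x₀ t₀ d := by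
    intro i x t h
    rw [mem_backwardCylinder] at h ⊢
    rwa [norm_coordReflection_sub]
  have hfix : ∀ i x, x i = x₀ i → coordReflection x₀ i x = x := by
    intro i x h
    simp [coordReflection, h]
  have hcontr : ∀ i, ContinuousOn (fun p : EuclideanSpace ℝ (Fin n) × ℝ =>
      u (coordReflection x₀ i p.1) p.2) (backwardCylinder x₀ t₀ d) := by
    intro i
    refine hcont.comp (f := fun p : EuclideanSpace ℝ (Fin n) × ℝ =>
      (coordReflection x₀ i p.1, p.2)) (Continuous.continuousOn ?_) fun p hp => hrefl i _ _ hp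
    unfold coordReflection
    fun_prop
  have main : ∀ i, ∀ A, M + (n + 1) * (N / d ^ 2) < A → ∀ s : ℝ, 0 < s → s ≤ d →
      |u (x₀ + s • EuclideanSpace.single i (1 : ℝ)) t₀ -
        u (x₀ - s • EuclideanSpace.single i (1 : ℝ)) t₀| ≤
        N / d ^ 2 * s ^ 2 + A * (2 * d * s - s ^ 2) := by
    intro i A hA s hs hsd
    have hNd : 0 ≤ N / d ^ 2 := by positivity
    have hA0 : 0 ≤ A := le_trans (by positivity) hA.le
    have hA' : 2 * M + (2 * n + 1) * (N / d ^ 2) < 2 * A := by nlinarith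
    have er : coordReflection x₀ i (x₀ + s • EuclideanSpace.single i (1 : ℝ))
        = x₀ - s • EuclideanSpace.single i (1 : ℝ) := by
      ext k; by_cases hk : k = i <;> simp [coordReflection, hk]; ring
    have hnorm : ‖x₀ + s • EuclideanSpace.single i (1 : ℝ) - x₀‖ = s := by
      simp [norm_smul, abs_of_pos hs]
    have hi : (x₀ + s • EuclideanSpace.single i (1 : ℝ)) i - x₀ i = s := by simp
    have h1 := le_of_nonpos_on_hyperplane (x := x₀ + s • EuclideanSpace.single i (1 : ℝ))
      (v := fun z τ => u z τ - u (coordReflection x₀ i z) τ)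
      (t₀ := t₀) i hd hN hA' hA0 (hcont.sub (hcontr i))
      (fun x t h => by linarith [(hu _ _ h).2, (hu _ _ (hrefl i _ _ h)).1])
      (fun x t h => by simp [hfix i x h])
      (fun x t h ht => by
        obtain ⟨c, hc, hv⟩ := heq x t h ht
        obtain ⟨c', hc', hv'⟩ := heq _ t (hrefl i _ _ h) ht
        exact ⟨_, by linarith [abs_le.1 hc, abs_le.1 hc'], hv.sub hv'.comp_coordReflection⟩)
      (hnorm.le.trans hsd) (by linarith)
    have h2 := le_of_nonpos_on_hyperplane (x := x₀ + s • EuclideanSpace.single i (1 : ℝ))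
      (v := fun z τ => u (coordReflection x₀ i z) τ - u z τ)
      (t₀ := t₀) i hd hN hA' hA0 ((hcontr i).sub hcont)
      (fun x t h => by linarith [(hu _ _ h).1, (hu _ _ (hrefl i _ _ h)).2])
      (fun x t h => by simp [hfix i x h])
      (fun x t h ht => by
        obtain ⟨c, hc, hv⟩ := heq x t h ht
        obtain ⟨c', hc', hv'⟩ := heq _ t (hrefl i _ _ h) ht
        exact ⟨_, by linarith [abs_le.1 hc, abs_le.1 hc'], hv'.comp_coordReflection.sub hv⟩)
      (hnorm.le.trans hsd) (by linarith)
    simp only [er, hnorm, hi] at h1 h2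
    exact abs_le.2 ⟨by linarith, h1⟩
  set L := fderiv ℝ (fun z => u z t₀) x₀ with hL
  have hcoord : ∀ i, |L (EuclideanSpace.single i 1)| ≤ M * d + (n + 1) * N / d := by
    intro i
    have h0 : M * d + (n + 1) * N / d = (M + (n + 1) * (N / d ^ 2)) * d := by field_simp
    rw [h0, ← div_le_iff₀ hd]
    refine le_of_forall_gt_imp_ge_of_dense fun A hA => ?_
    rw [div_le_iff₀ hd]
    have hline : ∀ k : ℝ, HasDerivAt (fun s : ℝ => u (x₀ + (k * s) • EuclideanSpace.single i 1) t₀)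
        (k * L (EuclideanSpace.single i 1)) 0 := by
      intro k
      have hl : HasDerivAt (fun s : ℝ => x₀ + (k * s) • EuclideanSpace.single i (1 : ℝ))
          (k • EuclideanSpace.single i (1 : ℝ)) 0 := by
        have := (((hasDerivAt_id (0 : ℝ)).const_mul k).smul_const
          (EuclideanSpace.single i (1 : ℝ))).const_add x₀
        simpa using this
      have hf : HasFDerivAt (fun z => u z t₀) L (x₀ + (k * 0) • EuclideanSpace.single i (1 : ℝ)) := by
        simpa using hdiff.hasFDerivAt
      have := hf.comp_hasDerivAt (0 : ℝ) hl
      rwa [map_smul, smul_eq_mul] at this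
    have hslope : Tendsto (fun s : ℝ => |(u (x₀ + s • EuclideanSpace.single i (1 : ℝ)) t₀ -
        u (x₀ - s • EuclideanSpace.single i (1 : ℝ)) t₀) / (2 * s)|) (𝓝[>] 0)
        (𝓝 |L (EuclideanSpace.single i 1)|) := by
      have h1 := ((hline 1).sub (hline (-1))).tendsto_slope_zero.const_mul (1 / 2)
      have hle : 𝓝[>] (0 : ℝ) ≤ 𝓝[≠] 0 := nhdsWithin_mono _ fun z hz => ne_of_gt hz
      have h2 := (h1.mono_left hle).abs
      refine (h2.congr fun s => ?_).trans (by ring_nf; rfl)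
      simp only [zero_add, Pi.sub_apply, one_mul, neg_mul, neg_smul, ← sub_eq_add_neg, smul_eq_mul,
        zero_smul, add_zero, sub_self, sub_zero]
      congr 1
      ring
    have hlim : Tendsto (fun s : ℝ => N / d ^ 2 * s / 2 + A * (d - s / 2)) (𝓝[>] 0)
        (𝓝 (A * d)) := by
      have : Tendsto (fun s : ℝ => N / d ^ 2 * s / 2 + A * (d - s / 2)) (𝓝 0)
        (𝓝 (N / d ^ 2 * 0 / 2 + A * (d - 0 / 2))) := Continuous.tendsto (by fun_prop) _
      simpa using this.mono_left nhdsWithin_le_nhds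
    refine le_of_tendsto_of_tendsto hslope hlim ?_
    filter_upwards [Ioo_mem_nhdsGT hd] with s hs
    have hs0 : 0 < 2 * s := by linarith [hs.1]
    rw [abs_div, abs_of_pos hs0, div_le_iff₀ hs0]
    refine (main i A hA s hs.1 hs.2.le).trans (le_of_eq ?_)
    ring
  refine L.opNorm_le_bound (by positivity) fun x => ?_
  have hx : x = ∑ i, x i • EuclideanSpace.single i (1 : ℝ) := by
    ext j
    simp [Finset.sum_apply, Pi.single_apply]
  conv_lhs => rw [hx]
  rw [map_sum]
  refine (norm_sum_le _ _).trans ?_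
  calc ∑ i, ‖L (x i • EuclideanSpace.single i (1 : ℝ))‖
      ≤ ∑ _i : Fin n, (M * d + (n + 1) * N / d) * ‖x‖ := by
        refine Finset.sum_le_sum fun i _ => ?_
        rw [map_smul, norm_smul, mul_comm, Real.norm_eq_abs, Real.norm_eq_abs]
        exact mul_le_mul (hcoord i) (abs_coord_le_norm x i) (abs_nonneg _) (by positivity)
    _ = n * (M * d + (n + 1) * N / d) * ‖x‖ := by simp; ring

/-- The moving paraboloid `ρ² + κ (t - t₀) - ‖x - ξ(t)‖²`, where `ξ` moves from `x₀` at time `t₀`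
with constant velocity `w`. -/
noncomputable def movingParaboloid {n : ℕ} (x₀ w : EuclideanSpace ℝ (Fin n)) (t₀ ρ κ : ℝ)
    (x : EuclideanSpace ℝ (Fin n)) (t : ℝ) : ℝ :=
  ρ ^ 2 + κ * (t - t₀) - ‖x - x₀ - (t - t₀) • w‖ ^ 2

lemma hasHeatValue_movingParaboloid_sq_div {n : ℕ} {x₀ w x : EuclideanSpace ℝ (Fin n)}
    {t₀ ρ κ t : ℝ} (k : ℕ) (hg : 0 < ρ ^ 2 + κ * (t - t₀)) :
    HasHeatValue (fun z s => movingParaboloid x₀ w t₀ ρ κ z s ^ 2 /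
        (ρ ^ 2 + κ * (s - t₀)) ^ (k + 2)) x t
      ((ρ ^ 2 + κ * (t - t₀))⁻¹ ^ (k + 2) *
        (2 * movingParaboloid x₀ w t₀ ρ κ x t * (κ + 2 * inner ℝ (x - x₀ - (t - t₀) • w) w)
          - (k + 2) * κ * movingParaboloid x₀ w t₀ ρ κ x t ^ 2 / (ρ ^ 2 + κ * (t - t₀))
          - (8 * ‖x - x₀ - (t - t₀) • w‖ ^ 2
            - 4 * n * movingParaboloid x₀ w t₀ ρ κ x t))) := by
  have hline : HasDerivAt (fun s : ℝ => x - x₀ - (s - t₀) • w) (-w) t := by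
    have h1 := (((hasDerivAt_id t).sub_const t₀).smul_const w).const_sub (x - x₀)
    simpa using h1
  have hgd : HasDerivAt (fun s : ℝ => ρ ^ 2 + κ * (s - t₀)) κ t := by
    have h1 := (((hasDerivAt_id t).sub_const t₀).const_mul κ).const_add (ρ ^ 2)
    simpa using h1
  have hP : HasDerivAt (fun s => movingParaboloid x₀ w t₀ ρ κ x s)
      (κ + 2 * inner ℝ (x - x₀ - (t - t₀) • w) w) t := by
    have h1 := hgd.sub hline.norm_sq
    refine h1.congr_deriv ?_
    rw [inner_neg_right]
    ring
  refine ⟨_, fun i => (ρ ^ 2 + κ * (t - t₀))⁻¹ ^ (k + 2) *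
    (8 * (x - x₀ - (t - t₀) • w) i ^ 2 - 4 * movingParaboloid x₀ w t₀ ρ κ x t),
    (hP.pow 2).div (hgd.pow (k + 2)) (by positivity), fun i => ?_, ?_⟩
  · have h : HasSymmSecondDeriv (fun z => movingParaboloid x₀ w t₀ ρ κ z t ^ 2) x
        (EuclideanSpace.single i 1)
        (8 * (x - x₀ - (t - t₀) • w) i ^ 2 - 4 * movingParaboloid x₀ w t₀ ρ κ x t) := by
      refine .of_eq_add 2 fun s => ?_
      unfold movingParaboloid
      have e1 : x + s • EuclideanSpace.single i (1 : ℝ) - x₀ - (t - t₀) • w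
        = (x - x₀ - (t - t₀) • w) + s • EuclideanSpace.single i (1 : ℝ) := by abel
      have e2 : x - s • EuclideanSpace.single i (1 : ℝ) - x₀ - (t - t₀) • w
        = (x - x₀ - (t - t₀) • w) - s • EuclideanSpace.single i (1 : ℝ) := by abel
      simp only [e1, e2]
      generalize x - x₀ - (t - t₀) • w = y
      rw [norm_add_sq_real, norm_sub_sq_real, norm_smul, inner_smul_right]
      simp [EuclideanSpace.inner_single_right]
      ring
    refine (h.const_mul ((ρ ^ 2 + κ * (t - t₀))⁻¹ ^ (k + 2))).congr fun s => ?_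
    simp only [div_eq_mul_inv, inv_pow]
    ring
  · have hsum : ∑ i, (x - x₀ - (t - t₀) • w) i ^ 2 = ‖x - x₀ - (t - t₀) • w‖ ^ 2 := by
      rw [EuclideanSpace.norm_sq_eq]
      simp
    rw [← Finset.mul_sum, Finset.sum_sub_distrib, ← Finset.mul_sum, hsum]
    simp only [Pi.pow_apply]
    generalize ρ ^ 2 + κ * (t - t₀) = g at hg
    generalize movingParaboloid x₀ w t₀ ρ κ x t = P
    simp
    field_simp
    ring

/-- Propagation of a lower bound: if `u ≥ h` on a ball at time `t₀`, then `u` is bounded below at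
the end of the moving ball with the power `ρ ^ (2 * k)` of the initial radius. -/
lemma lower_bound_propagation {n : ℕ} {u : EuclideanSpace ℝ (Fin n) → ℝ → ℝ}
    {x₀ w : EuclideanSpace ℝ (Fin n)} {t₀ t₁ ρ κ M h B : ℝ} {k : ℕ}
    (hρ : 0 < ρ) (hκ : 0 ≤ κ) (hh : 0 < h) (ht : t₀ ≤ t₁)
    (hB : ∀ y : EuclideanSpace ℝ (Fin n), ∀ t ∈ Icc t₀ t₁,
      ‖y‖ ^ 2 ≤ ρ ^ 2 + κ * (t - t₀) → 2 * κ + 4 * inner ℝ y w + 4 * n + 8 ≤ B)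
    (hk : B ^ 2 < 32 * ((k + 2) * κ))
    (hcont : ContinuousOn (fun p : EuclideanSpace ℝ (Fin n) × ℝ => u p.1 p.2)
      {p | p.2 ∈ Icc t₀ t₁ ∧ ‖p.1 - x₀ - (p.2 - t₀) • w‖ ^ 2 ≤ ρ ^ 2 + κ * (p.2 - t₀)})
    (hu : ∀ x, ∀ t ∈ Icc t₀ t₁,
      ‖x - x₀ - (t - t₀) • w‖ ^ 2 ≤ ρ ^ 2 + κ * (t - t₀) → 0 ≤ u x t)
    (hM : 0 ≤ M)
    (heq : ∀ x, ∀ t ∈ Icc t₀ t₁, ‖x - x₀ - (t - t₀) • w‖ ^ 2 ≤ ρ ^ 2 + κ * (t - t₀) →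
      ∃ c, |c| ≤ M ∧ HasHeatValue u x t c)
    (hbot : ∀ x, ‖x - x₀‖ ≤ ρ → h ≤ u x t₀) :
    h * (ρ ^ 2 / (ρ ^ 2 + κ * (t₁ - t₀))) ^ k - M * (t₁ - t₀) ≤ u (x₀ + (t₁ - t₀) • w) t₁ := by
  set K : Set (EuclideanSpace ℝ (Fin n) × ℝ) :=
    {p | p.2 ∈ Icc t₀ t₁ ∧ ‖p.1 - x₀ - (p.2 - t₀) • w‖ ^ 2 ≤ ρ ^ 2 + κ * (p.2 - t₀)} with hKdef
  have hg : ∀ t, t₀ ≤ t → 0 < ρ ^ 2 + κ * (t - t₀) := fun t h => by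
    have := mul_nonneg hκ (sub_nonneg.2 h)
    positivity
  have hK : IsCompact K := by
    have hc : IsCompact ((fun p : EuclideanSpace ℝ (Fin n) × ℝ =>
        (p.1 + x₀ + (p.2 - t₀) • w, p.2)) ''
        (Metric.closedBall (0 : EuclideanSpace ℝ (Fin n)) (√(ρ ^ 2 + κ * (t₁ - t₀))) ×ˢ
          Icc t₀ t₁)) :=
      ((isCompact_closedBall _ _).prod isCompact_Icc).image (by fun_prop)
    refine hc.of_isClosed_subset ?_ ?_
    · have hcl : IsClosed {p : EuclideanSpace ℝ (Fin n) × ℝ |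
          ‖p.1 - x₀ - (p.2 - t₀) • w‖ ^ 2 ≤ ρ ^ 2 + κ * (p.2 - t₀)} :=
        isClosed_le (by fun_prop) (by fun_prop)
      exact (isClosed_Icc.preimage continuous_snd).inter hcl
    · rintro ⟨x, t⟩ ⟨h1, h2⟩
      refine ⟨(x - x₀ - (t - t₀) • w, t), ⟨?_, h1⟩, ?_⟩
      · rw [mem_closedBall_zero_iff]
        refine Real.le_sqrt_of_sq_le (h2.trans ?_)
        have := mul_le_mul_of_nonneg_left (sub_le_sub_right h1.2 t₀) hκ
        simpa using this
      · simp only [Prod.mk.injEq, and_true]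
        abel
  have key := nonpos_of_hasHeatValue_neg (F := fun z s => h * ρ ^ (2 * k) *
      (movingParaboloid x₀ w t₀ ρ κ z s ^ 2 / (ρ ^ 2 + κ * (s - t₀)) ^ (k + 2))
      - u z s - M * (s - t₀)) (x := x₀ + (t₁ - t₀) • w) (t := t₁) hK ?_ ?_ ?_
  · have e : movingParaboloid x₀ w t₀ ρ κ (x₀ + (t₁ - t₀) • w) t₁ = ρ ^ 2 + κ * (t₁ - t₀) := by
      simp [movingParaboloid]
    simp only [e] at key
    have hg1 := hg t₁ ht
    have e2 : h * (ρ ^ 2 / (ρ ^ 2 + κ * (t₁ - t₀))) ^ k = h * ρ ^ (2 * k) *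
        ((ρ ^ 2 + κ * (t₁ - t₀)) ^ 2 / (ρ ^ 2 + κ * (t₁ - t₀)) ^ (k + 2)) := by
      rw [div_pow, pow_add, pow_mul]
      field_simp
    linarith
  · refine ContinuousOn.sub (ContinuousOn.sub (ContinuousOn.mul continuousOn_const
      (ContinuousOn.div ?_ ?_ ?_)) hcont) ?_
    · unfold movingParaboloid
      fun_prop
    · fun_prop
    · intro p hp
      exact (pow_pos (hg _ hp.1.1) _).ne'
    · fun_prop
  · rintro x t ⟨h1, h2⟩
    simp only at h1 h2
    have hgt := hg t h1.1
    have hut := hu x t h1 h2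
    have hMt : 0 ≤ M * (t - t₀) := mul_nonneg hM (by linarith [h1.1])
    rcases h2.eq_or_lt with h3 | h3
    · left
      have e : movingParaboloid x₀ w t₀ ρ κ x t = 0 := by
        simp [movingParaboloid, h3]
      simp only [e]
      simp
      linarith
    rcases h1.1.eq_or_lt with h4 | h4
    · left
      subst h4
      simp only [movingParaboloid, sub_self, mul_zero, add_zero, zero_smul, sub_zero] at h2 ⊢
      have h5 := hbot x ((sq_le_sq₀ (norm_nonneg _) hρ.le).1 h2)
      have h6 : (ρ ^ 2 - ‖x - x₀‖ ^ 2) ^ 2 ≤ (ρ ^ 2) ^ 2 :=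
        pow_le_pow_left₀ (by linarith) (by nlinarith [sq_nonneg ‖x - x₀‖]) 2
      have h7 : h * ρ ^ (2 * k) * ((ρ ^ 2 - ‖x - x₀‖ ^ 2) ^ 2 / (ρ ^ 2) ^ (k + 2)) ≤
          h * ρ ^ (2 * k) * ((ρ ^ 2) ^ 2 / (ρ ^ 2) ^ (k + 2)) := by gcongr
      have h8 : h * ρ ^ (2 * k) * ((ρ ^ 2) ^ 2 / (ρ ^ 2) ^ (k + 2)) = h := by
        rw [pow_add, pow_mul]
        field_simp
      linarith
    right
    refine ⟨?_, ?_, ?_⟩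
    · obtain ⟨c, hc, hv⟩ := heq x t h1 h2
      refine ⟨_, ?_, (((hasHeatValue_movingParaboloid_sq_div k hgt).const_mul
        (h * ρ ^ (2 * k))).sub hv).sub ((HasHeatValue.time t₀).const_mul M)⟩
      have hb := hB (x - x₀ - (t - t₀) • w) t h1 h2
      have hP : 0 < movingParaboloid x₀ w t₀ ρ κ x t := sub_pos.2 h3
      have hPy : ‖x - x₀ - (t - t₀) • w‖ ^ 2 =
        ρ ^ 2 + κ * (t - t₀) - movingParaboloid x₀ w t₀ ρ κ x t := by simp [movingParaboloid]
      rw [hPy]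
      generalize movingParaboloid x₀ w t₀ ρ κ x t = P at hP
      generalize ρ ^ 2 + κ * (t - t₀) = g at hgt
      generalize (inner ℝ (x - x₀ - (t - t₀) • w) w : ℝ) = I at hb
      have hneg : 2 * P * (κ + 2 * I) - (k + 2) * κ * P ^ 2 / g - (8 * (g - P) - 4 * n * P) < 0 := by
        have e : 2 * P * (κ + 2 * I) - (k + 2) * κ * P ^ 2 / g - (8 * (g - P) - 4 * n * P) =
          P * (2 * κ + 4 * I + 4 * n + 8) - (k + 2) * κ * P ^ 2 / g - 8 * g := by ring
        rw [e]
        have h5 := mul_le_mul_of_nonneg_left hb hP.le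
        have h6 : P * B < (k + 2) * κ * P ^ 2 / g + 8 * g := by
          have e2 : (k + 2) * κ * P ^ 2 / g + 8 * g = ((k + 2) * κ * P ^ 2 + 8 * g ^ 2) / g := by
            field_simp
          rw [e2, lt_div_iff₀ hgt]
          nlinarith [sq_nonneg (P * B - 16 * g), mul_lt_mul_of_pos_right hk (pow_pos hP 2)]
        linarith
      have hpos : 0 < h * ρ ^ (2 * k) * g⁻¹ ^ (k + 2) := by positivity
      have := mul_neg_of_pos_of_neg hpos hneg
      linarith [abs_le.1 hc]
    · have c1 : Continuous fun s : ℝ => ‖x - x₀ - (s - t₀) • w‖ ^ 2 - (ρ ^ 2 + κ * (s - t₀)) := by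
        fun_prop
      have e1 : ∀ᶠ s in 𝓝 t, ‖x - x₀ - (s - t₀) • w‖ ^ 2 - (ρ ^ 2 + κ * (s - t₀)) < 0 :=
        (c1.tendsto t).eventually_lt_const (by linarith)
      filter_upwards [Ioo_mem_nhdsLT h4, nhdsWithin_le_nhds e1] with τ hτ h5
      exact ⟨⟨hτ.1.le, hτ.2.le.trans h1.2⟩, by simpa using h5.le⟩
    · intro j
      have c1 : Continuous fun s : ℝ =>
          ‖x + s • EuclideanSpace.single j (1 : ℝ) - x₀ - (t - t₀) • w‖ ^ 2 := by fun_prop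
      have e1 : ∀ᶠ s : ℝ in 𝓝 0,
          ‖x + s • EuclideanSpace.single j (1 : ℝ) - x₀ - (t - t₀) • w‖ ^ 2
            < ρ ^ 2 + κ * (t - t₀) :=
        (c1.tendsto 0).eventually_lt_const (by simpa using h3)
      filter_upwards [e1] with τ h5
      exact ⟨h1, h5.le⟩
  · refine ⟨⟨ht, le_rfl⟩, ?_⟩
    simpa using (hg t₁ ht).le

/-- `u` is nonnegative and continuous on the parabolic cylinder of radius `r`, is differentiable
in space in its interior, and satisfies `|∂ₜu - Δu| ≤ M` there. -/
structure IsNonnegAlmostCaloric {n : ℕ} (u : EuclideanSpace ℝ (Fin n) → ℝ → ℝ) (r M : ℝ) :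
    Prop where
  nonneg : ∀ x t, ‖x‖ < r → t ∈ Icc (-r ^ 2) (0 : ℝ) → 0 ≤ u x t
  continuousOn : ContinuousOn (fun p : EuclideanSpace ℝ (Fin n) × ℝ => u p.1 p.2)
    {p | ‖p.1‖ < r ∧ p.2 ∈ Icc (-r ^ 2) (0 : ℝ)}
  differentiableAt : ∀ x t, ‖x‖ < r → t ∈ Ioo (-r ^ 2) (0 : ℝ) →
    DifferentiableAt ℝ (fun z => u z t) x
  heat : ∀ x t, ‖x‖ < r → t ∈ Ioo (-r ^ 2) (0 : ℝ) → ∃ c, |c| ≤ M ∧ HasHeatValue u x t c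

namespace IsNonnegAlmostCaloric

variable {n : ℕ} {u : EuclideanSpace ℝ (Fin n) → ℝ → ℝ} {r M : ℝ}

/-- A lower bound on a small ball at an earlier time propagates to the origin. -/
lemma lower_bound_at_origin (hu : IsNonnegAlmostCaloric u r M) (hr : 0 < r) (hM : 0 ≤ M)
    {x₀ : EuclideanSpace ℝ (Fin n)} {t₀ ρ h : ℝ} (hx₀ : ‖x₀‖ ≤ 3 / 4 * r)
    (ht₀ : -(3 / 4) * r ^ 2 ≤ t₀) (ht₀' : t₀ ≤ -(1 / 3) * r ^ 2) (hρ : 0 < ρ) (hρr : ρ ≤ r / 8)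
    (hh : 0 < h) (hbot : ∀ x, ‖x - x₀‖ ≤ ρ → h ≤ u x t₀) :
    h * (ρ / r) ^ (2 * (2 * (4 * n + 13) ^ 2)) ≤ u 0 0 + M * r ^ 2 := by
  set k : ℕ := 2 * (4 * n + 13) ^ 2 with hk
  have hr2 : 0 < r ^ 2 := by positivity
  have hρ2 : ρ ^ 2 ≤ r ^ 2 / 64 := by
    calc ρ ^ 2 ≤ (r / 8) ^ 2 := pow_le_pow_left₀ hρ.le hρr 2
      _ = r ^ 2 / 64 := by ring
  have main : ∀ t₁, -(1 / 12) * r ^ 2 < t₁ → t₁ < 0 →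
      h * (ρ / r) ^ (2 * k) - M * r ^ 2 ≤ u 0 t₁ := by
    intro t₁ h1 h2
    have hT : r ^ 2 / 4 ≤ t₁ - t₀ := by linarith
    have hT0 : 0 < t₁ - t₀ := by linarith
    set w : EuclideanSpace ℝ (Fin n) := (-(t₁ - t₀)⁻¹) • x₀ with hw
    have hg : ∀ t ∈ Icc t₀ t₁, ρ ^ 2 + 1 / 48 * (t - t₀) ≤ r ^ 2 / 32 := by
      intro t ht
      linarith [ht.1, ht.2]
    have hnorm : ∀ y : EuclideanSpace ℝ (Fin n), ∀ t ∈ Icc t₀ t₁,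
        ‖y‖ ^ 2 ≤ ρ ^ 2 + 1 / 48 * (t - t₀) → ‖y‖ < r / 4 := by
      intro y t ht hy
      refine lt_of_pow_lt_pow_left₀ 2 (by positivity) ?_
      have := hg t ht
      nlinarith
    have hwn : ‖w‖ ≤ 3 / r := by
      rw [hw, norm_smul, norm_neg, norm_inv, Real.norm_of_nonneg hT0.le, inv_mul_le_iff₀ hT0]
      calc ‖x₀‖ ≤ 3 / 4 * r := hx₀
        _ = r ^ 2 / 4 * (3 / r) := by field_simp
        _ ≤ (t₁ - t₀) * (3 / r) := by gcongr
    have hdom : ∀ x, ∀ t ∈ Icc t₀ t₁, ‖x - x₀ - (t - t₀) • w‖ ^ 2 ≤ ρ ^ 2 + 1 / 48 * (t - t₀) →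
        ‖x‖ < r ∧ t ∈ Ioo (-r ^ 2) (0 : ℝ) := by
      intro x t ht hx
      refine ⟨?_, by linarith [ht.1], ht.2.trans_lt h2⟩
      have e : x = (x - x₀ - (t - t₀) • w) + (1 - (t - t₀) / (t₁ - t₀)) • x₀ := by
        rw [hw]
        module
      have hq0 : 0 ≤ (t - t₀) / (t₁ - t₀) := div_nonneg (by linarith [ht.1]) hT0.le
      have hq1 : (t - t₀) / (t₁ - t₀) ≤ 1 := (div_le_one hT0).2 (by linarith [ht.2])
      have hx' : ‖(1 - (t - t₀) / (t₁ - t₀)) • x₀‖ ≤ ‖x₀‖ := by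
        rw [norm_smul, Real.norm_of_nonneg (by linarith)]
        exact mul_le_of_le_one_left (norm_nonneg _) (by linarith)
      have hn := hnorm _ t ht hx
      have := norm_add_le (x - x₀ - (t - t₀) • w) ((1 - (t - t₀) / (t₁ - t₀)) • x₀)
      rw [← e] at this
      linarith
    have key := lower_bound_propagation (u := u) (x₀ := x₀) (w := w) (t₀ := t₀) (t₁ := t₁)
      (κ := 1 / 48) (M := M) (B := 4 * n + 13) (k := k) hρ (by norm_num) hh (by linarith)
      ?_ ?_ ?_ ?_ hM ?_ hbot
    · have e : x₀ + (t₁ - t₀) • w = 0 := by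
        rw [hw, smul_smul, mul_neg, mul_inv_cancel₀ hT0.ne']
        simp
      rw [e] at key
      have hgt := hg t₁ ⟨by linarith, le_rfl⟩
      have hg0 : 0 < ρ ^ 2 + 1 / 48 * (t₁ - t₀) := by positivity
      have e1 : (ρ / r) ^ (2 * k) ≤ (ρ ^ 2 / (ρ ^ 2 + 1 / 48 * (t₁ - t₀))) ^ k := by
        rw [pow_mul, div_pow]
        gcongr
        linarith
      have e2 := mul_le_mul_of_nonneg_left e1 hh.le
      have e3 : M * (t₁ - t₀) ≤ M * r ^ 2 := mul_le_mul_of_nonneg_left (by linarith) hM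
      linarith
    · intro y t ht hy
      have h3 : inner ℝ y w ≤ (r / 4) * (3 / r) := (real_inner_le_norm y w).trans
        (mul_le_mul (hnorm y t ht hy).le hwn (norm_nonneg _) (by positivity))
      have h4 : (r / 4) * (3 / r) = 3 / 4 := by field_simp
      rw [h4] at h3
      linarith
    · rw [hk]
      push_cast
      nlinarith [sq_nonneg (4 * (n : ℝ) + 13)]
    · exact hu.continuousOn.mono fun p hp => ⟨(hdom _ _ hp.1 hp.2).1,
        Ioo_subset_Icc_self (hdom _ _ hp.1 hp.2).2⟩
    · intro x t ht hx
      exact hu.nonneg _ _ (hdom x t ht hx).1 (Ioo_subset_Icc_self (hdom x t ht hx).2)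
    · intro x t ht hx
      exact hu.heat _ _ (hdom x t ht hx).1 (hdom x t ht hx).2
  have hlim : Tendsto (fun t => u 0 t) (𝓝[<] 0) (𝓝 (u 0 0)) := by
    have h1 := hu.continuousOn (0, 0) ⟨by simpa using hr, by linarith, le_rfl⟩
    have h2 : Tendsto (fun t : ℝ => ((0 : EuclideanSpace ℝ (Fin n)), t)) (𝓝[<] 0)
        (𝓝[{p | ‖p.1‖ < r ∧ p.2 ∈ Icc (-r ^ 2) (0 : ℝ)}] (0, 0)) := by
      refine tendsto_nhdsWithin_iff.2 ⟨?_, ?_⟩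
      · exact (Continuous.tendsto (by fun_prop) (0 : ℝ)).mono_left nhdsWithin_le_nhds
      · filter_upwards [Ioo_mem_nhdsLT (show -r ^ 2 < (0 : ℝ) by linarith)] with t ht
        exact ⟨by simpa using hr, ht.1.le, ht.2.le⟩
    exact h1.tendsto.comp h2
  have := ge_of_tendsto hlim (b := h * (ρ / r) ^ (2 * k) - M * r ^ 2) (by
    filter_upwards [Ioo_mem_nhdsLT (show -(1 / 12) * r ^ 2 < (0 : ℝ) by linarith)] with t ht
    exact main t ht.1 ht.2)
  linarith

set_option maxHeartbeats 1000000 in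
/-- Parabolic Harnack inequality, weighted by a power of the distance to the boundary. -/
lemma harnack (n : ℕ) : ∃ (p : ℕ) (C : ℝ), 0 < C ∧
    ∀ (u : EuclideanSpace ℝ (Fin n) → ℝ → ℝ) (r M : ℝ), 0 < r → 0 ≤ M →
    IsNonnegAlmostCaloric u r M → ∀ x t, ‖x‖ ≤ 3 / 4 * r → -(3 / 4) * r ^ 2 ≤ t →
    t ≤ -(1 / 3) * r ^ 2 →
    u x t * (min (3 / 4 * r - ‖x‖) ((t + 3 / 4 * r ^ 2) / r)) ^ p
      ≤ C * (u 0 0 + M * r ^ 2) * r ^ p := by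
  obtain ⟨p, hp⟩ : ∃ p : ℕ, p = 2 * (2 * (4 * n + 13) ^ 2) := ⟨_, rfl⟩
  obtain ⟨θ, hθ⟩ : ∃ θ : ℝ, θ = 1 / (8 * (n + 1) ^ 2 * 2 ^ p) := ⟨_, rfl⟩
  have h2p : (1 : ℝ) ≤ 2 ^ p := one_le_pow₀ (by norm_num)
  have hθ0 : 0 < θ := by rw [hθ]; positivity
  have hn0 : (0 : ℝ) ≤ n := Nat.cast_nonneg n
  have hθe : θ * (8 * (n + 1) ^ 2 * 2 ^ p) = 1 := by rw [hθ]; field_simp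
  have hθn : θ * (n * (n + 1) * 2 ^ p) ≤ 1 / 8 := by
    have : θ * (n * (n + 1) * 2 ^ p) ≤ θ * ((n + 1) ^ 2 * 2 ^ p) := by
      gcongr
      nlinarith
    linarith
  have hθn' : θ * n ≤ 1 / 8 := by
    have : θ * n ≤ θ * (n * (n + 1) * 2 ^ p) := by
      gcongr
      rw [mul_assoc]
      exact le_mul_of_one_le_right hn0 (one_le_mul_of_one_le_of_one_le (by linarith) h2p)
    linarith
  have hθh : θ ≤ 1 / 2 := by
    have h1 : (1 : ℝ) ≤ (n + 1) ^ 2 * 2 ^ p :=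
      one_le_mul_of_one_le_of_one_le (one_le_pow₀ (by linarith)) h2p
    nlinarith
  refine ⟨p, 4 / 3 * ((2 / θ) ^ p + 1), by positivity, ?_⟩
  intro u r M hr hM hu x t hx ht ht'
  have hr2 : 0 < r ^ 2 := by positivity
  have hu00 : 0 ≤ u 0 0 := hu.nonneg 0 0 (by simpa using hr) ⟨by linarith, le_rfl⟩
  have hMr : 0 ≤ M * r ^ 2 := by positivity
  obtain ⟨δ, hδ⟩ : ∃ δ : EuclideanSpace ℝ (Fin n) → ℝ → ℝ,
    δ = fun x t => min (3 / 4 * r - ‖x‖) ((t + 3 / 4 * r ^ 2) / r) := ⟨_, rfl⟩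
  obtain ⟨D, hD⟩ : ∃ D : Set (EuclideanSpace ℝ (Fin n) × ℝ),
    D = Metric.closedBall 0 (3 / 4 * r) ×ˢ Icc (-(3 / 4) * r ^ 2) (-(1 / 3) * r ^ 2) := ⟨_, rfl⟩
  have hDmem : ∀ y s, (y, s) ∈ D ↔
      ‖y‖ ≤ 3 / 4 * r ∧ -(3 / 4) * r ^ 2 ≤ s ∧ s ≤ -(1 / 3) * r ^ 2 := by
    intro y s
    simp [hD]
  have hDdom : ∀ y s, (y, s) ∈ D → ‖y‖ < r ∧ s ∈ Ioo (-r ^ 2) (0 : ℝ) := by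
    intro y s h
    obtain ⟨h1, h2, h3⟩ := (hDmem y s).1 h
    exact ⟨by linarith, by linarith, by linarith⟩
  have hDsub : D ⊆ {p | ‖p.1‖ < r ∧ p.2 ∈ Icc (-r ^ 2) (0 : ℝ)} := fun q hq =>
    ⟨(hDdom q.1 q.2 hq).1, Ioo_subset_Icc_self (hDdom q.1 q.2 hq).2⟩
  have hDc : IsCompact D := hD ▸ (isCompact_closedBall _ _).prod isCompact_Icc
  have hm : ContinuousOn (fun q : EuclideanSpace ℝ (Fin n) × ℝ => u q.1 q.2 * δ q.1 q.2 ^ p) D := by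
    refine (hu.continuousOn.mono hDsub).mul (Continuous.continuousOn ?_)
    rw [hδ]
    fun_prop
  obtain ⟨⟨x₀, t₀⟩, hx₀, hmax⟩ := hDc.exists_isMaxOn ⟨(x, t), (hDmem x t).2 ⟨hx, ht, ht'⟩⟩ hm
  have hmax' : ∀ y s, (y, s) ∈ D → u y s * δ y s ^ p ≤ u x₀ t₀ * δ x₀ t₀ ^ p :=
    fun y s h => hmax h
  have hgoal := hmax' x t ((hDmem x t).2 ⟨hx, ht, ht'⟩)
  have hδxt : min (3 / 4 * r - ‖x‖) ((t + 3 / 4 * r ^ 2) / r) = δ x t := by rw [hδ]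
  rw [hδxt]
  refine hgoal.trans ?_
  obtain ⟨H, hH⟩ : ∃ H, H = u x₀ t₀ := ⟨_, rfl⟩
  obtain ⟨e, he⟩ : ∃ e, e = δ x₀ t₀ := ⟨_, rfl⟩
  rw [← hH, ← he] at hmax' ⊢
  obtain ⟨hx₀n, ht₀, ht₀'⟩ := (hDmem _ _).1 hx₀
  have hH0 : 0 ≤ H := hH ▸ hu.nonneg _ _ (hDdom _ _ hx₀).1 (Ioo_subset_Icc_self (hDdom _ _ hx₀).2)
  have he1 : e ≤ 3 / 4 * r - ‖x₀‖ := by rw [he, hδ]; exact min_le_left _ _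
  have he2 : e * r ≤ t₀ + 3 / 4 * r ^ 2 := by
    rw [← le_div_iff₀ hr, he, hδ]
    exact min_le_right _ _
  have he0 : 0 ≤ e := by
    rw [he, hδ]
    exact le_min (by linarith) (div_nonneg (by linarith) hr.le)
  have her : e ≤ 5 / 12 * r := by nlinarith
  have hrhs : 0 ≤ r ^ p := by positivity
  have hep : e ^ p ≤ r ^ p := pow_le_pow_left₀ he0 (by linarith) p
  have hθp : 0 < (2 / θ) ^ p := by positivity
  rcases he0.eq_or_lt with h0 | hepos
  · rw [← h0, zero_pow (by rw [hp]; positivity), mul_zero]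
    positivity
  -- a lower bound for `u` on a small ball around the maximum point
  have hcyl : ∀ y s, (y, s) ∈ backwardCylinder x₀ t₀ (e / 2) → (y, s) ∈ D ∧ u y s ≤ 2 ^ p * H := by
    intro y s h
    obtain ⟨h1, h2, h3⟩ := mem_backwardCylinder.1 h
    have hy : ‖y‖ ≤ ‖x₀‖ + e / 2 := by
      have := norm_add_le (y - x₀) x₀
      rw [sub_add_cancel] at this
      linarith
    have hs : e / 2 * r ≤ s + 3 / 4 * r ^ 2 := by nlinarith
    have hyD : (y, s) ∈ D := (hDmem y s).2 ⟨by linarith, by nlinarith, by linarith⟩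
    refine ⟨hyD, ?_⟩
    have hδy : e / 2 ≤ δ y s := by
      rw [hδ]
      exact le_min (by linarith) ((le_div_iff₀ hr).2 hs)
    have h4 := hmax' y s hyD
    have h5 : u y s * (e / 2) ^ p ≤ H * e ^ p := by
      refine le_trans ?_ h4
      have := hu.nonneg y s (hDdom _ _ hyD).1 (Ioo_subset_Icc_self (hDdom _ _ hyD).2)
      gcongr
    have h6 : H * e ^ p = (2 ^ p * H) * (e / 2) ^ p := by
      rw [div_pow]
      field_simp
    rw [h6] at h5
    exact le_of_mul_le_mul_right h5 (by positivity)
  have hsub : ∀ y, ‖y - x₀‖ ≤ e / 4 →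
      backwardCylinder y t₀ (e / 4) ⊆ backwardCylinder x₀ t₀ (e / 2) := by
    rintro y hy ⟨z, s⟩ hz
    obtain ⟨h1, h2, h3⟩ := mem_backwardCylinder.1 hz
    refine mem_backwardCylinder.2 ⟨?_, by nlinarith, h3⟩
    have := norm_add_le (z - y) (y - x₀)
    rw [sub_add_sub_cancel] at this
    linarith
  have hgrad : ∀ y, ‖y - x₀‖ ≤ e / 4 → ‖fderiv ℝ (fun z => u z t₀) y‖ ≤
      n * (M * (e / 4) + (n + 1) * (2 ^ p * H) / (e / 4)) := by
    intro y hy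
    have hyD := (hcyl y t₀ (mem_backwardCylinder.2 ⟨by linarith, by nlinarith, le_rfl⟩)).1
    refine norm_fderiv_le_of_hasHeatValue (by positivity) hM ?_ ?_ ?_
      (hu.differentiableAt _ _ (hDdom _ _ hyD).1 (hDdom _ _ hyD).2)
    · exact hu.continuousOn.mono fun q hq => hDsub (hcyl q.1 q.2 (hsub y hy hq)).1
    · intro z s hz
      have h1 := hcyl z s (hsub y hy hz)
      have h2 := hDdom z s h1.1
      exact ⟨hu.nonneg z s h2.1 (Ioo_subset_Icc_self h2.2), h1.2⟩
    · intro z s hz _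
      have h2 := hDdom z s (hcyl z s (hsub y hy hz)).1
      exact hu.heat z s h2.1 h2.2
  have hθe2 : θ * e / 2 ≤ e / 4 := by nlinarith
  have hlow : ∀ y, ‖y - x₀‖ ≤ θ * e / 2 → 3 / 4 * H - M * r ^ 2 ≤ u y t₀ := by
    intro y hy
    have h1 := (convex_closedBall x₀ (e / 4)).norm_image_sub_le_of_norm_fderiv_le
      (f := fun z => u z t₀) (𝕜 := ℝ) (x := x₀) (y := y)
      (fun z hz => by
        rw [mem_closedBall_iff_norm] at hz
        have hzD := hDdom _ _ (hcyl z t₀ (mem_backwardCylinder.2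
          ⟨by linarith, by nlinarith, le_rfl⟩)).1
        exact hu.differentiableAt _ _ hzD.1 hzD.2)
      (fun z hz => hgrad z (mem_closedBall_iff_norm.1 hz))
      (Metric.mem_closedBall_self (by positivity))
      (mem_closedBall_iff_norm.2 (hy.trans hθe2))
    have h2 : n * (M * (e / 4) + (n + 1) * (2 ^ p * H) / (e / 4)) * ‖y - x₀‖ ≤
        n * (M * (e / 4) + (n + 1) * (2 ^ p * H) / (e / 4)) * (θ * e / 2) := by gcongr
    have h3 : n * (M * (e / 4) + (n + 1) * (2 ^ p * H) / (e / 4)) * (θ * e / 2) =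
        (θ * n) * (M * e ^ 2 / 8) + θ * (n * (n + 1) * 2 ^ p) * (2 * H) := by
      field_simp
      ring
    have h4 : (θ * n) * (M * e ^ 2 / 8) ≤ M * r ^ 2 := by
      have : M * e ^ 2 ≤ M * r ^ 2 := by gcongr; linarith
      have h5 : 0 ≤ M * e ^ 2 := by positivity
      have h6 : (θ * n) * (M * e ^ 2 / 8) ≤ 1 / 8 * (M * e ^ 2 / 8) := by gcongr
      linarith
    have h5 : θ * (n * (n + 1) * 2 ^ p) * (2 * H) ≤ 1 / 8 * (2 * H) := by gcongr
    rw [Real.norm_eq_abs] at h1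
    have h6 := (abs_le.1 h1).1
    rw [← hH] at h6
    linarith
  have hfin : H ≤ 4 / 3 * (M * r ^ 2) ∨ 0 < 3 / 4 * H - M * r ^ 2 := by
    by_cases h : H ≤ 4 / 3 * (M * r ^ 2)
    · exact .inl h
    · right; linarith [not_le.1 h]
  have hA : (3 / 4 * H - M * r ^ 2) * e ^ p ≤ (2 / θ) ^ p * (u 0 0 + M * r ^ 2) * r ^ p := by
    rcases hfin with h | h
    · refine le_trans (mul_nonpos_of_nonpos_of_nonneg (by linarith) (by positivity)) (by positivity)
    · have h1 := hu.lower_bound_at_origin hr hM hx₀n ht₀ ht₀' (ρ := θ * e / 2) (by positivity)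
        (by nlinarith) h hlow
      rw [← hp] at h1
      have h2 : (3 / 4 * H - M * r ^ 2) * e ^ p =
          (2 / θ) ^ p * ((3 / 4 * H - M * r ^ 2) * (θ * e / 2 / r) ^ p) * r ^ p := by
        have : e ^ p = (2 / θ) ^ p * (θ * e / 2 / r) ^ p * r ^ p := by
          rw [← mul_pow, ← mul_pow]
          congr 1
          field_simp
        rw [this]
        ring
      rw [h2]
      gcongr
  have hB : M * r ^ 2 * e ^ p ≤ (u 0 0 + M * r ^ 2) * r ^ p :=
    mul_le_mul (by linarith) hep (by positivity) (by positivity)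
  linarith

end IsNonnegAlmostCaloric

lemma hasSymmSecondDeriv_secondPartial {n : ℕ} {f : EuclideanSpace ℝ (Fin n) → ℝ}
    {s : Set (EuclideanSpace ℝ (Fin n))} (hs : IsOpen s) (hf : ContDiffOn ℝ 2 f s)
    {x : EuclideanSpace ℝ (Fin n)} (hx : x ∈ s) (i : Fin n) :
    HasSymmSecondDeriv f x (EuclideanSpace.single i 1) (secondPartial f x i) := by
  set v : EuclideanSpace ℝ (Fin n) := EuclideanSpace.single i 1 with hv
  have hline : ∀ τ : ℝ, HasDerivAt (fun τ : ℝ => x + τ • v) v τ := fun τ => by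
    simpa using ((hasDerivAt_id τ).smul_const v).const_add x
  refine .of_hasDerivAt (f' := fun τ => fderiv ℝ f (x + τ • v) v) ?_ ?_
  · have hc : Tendsto (fun τ : ℝ => x + τ • v) (𝓝 0) (𝓝 x) := by
      simpa using (hline 0).continuousAt.tendsto
    filter_upwards [hc.eventually (hs.mem_nhds hx)] with τ hτ
    have h1 : DifferentiableAt ℝ f (x + τ • v) :=
      (hf.differentiableOn (by norm_num)).differentiableAt (hs.mem_nhds hτ)
    exact h1.hasFDerivAt.comp_hasDerivAt τ (hline τ)
  · have h1 : DifferentiableAt ℝ (fderiv ℝ f) x :=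
      ((hf.fderiv_of_isOpen hs (m := 1) (by norm_num)).differentiableOn
        (by norm_num)).differentiableAt (hs.mem_nhds hx)
    have h2 : DifferentiableAt ℝ (fun y => fderiv ℝ f y v) x :=
      h1.clm_apply (differentiableAt_const v)
    have h3 : HasFDerivAt (fun y => fderiv ℝ f y v) (fderiv ℝ (fun y => fderiv ℝ f y v) x)
        (x + (0 : ℝ) • v) := by
      simpa using h2.hasFDerivAt
    exact h3.comp_hasDerivAt (0 : ℝ) (hline 0)

/-- estimate (1.15): the key intermediate scale-by-scale estimate.  For
every `0 < r ≤ R`, on `A_r = {(x,t) : -(2/3)r² < t < -(1/3)r², |x| < r/√3}` one has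
`u/r + |∇ₓu| ≤ C₃ (u(0,0)/r + M r)`. -/
theorem parabolic_gradient_estimate_all_scales (n : ℕ) :
    ∃ C₃ : ℝ, 0 < C₃ ∧
      ∀ (R M : ℝ), 0 < R → 0 ≤ M →
      ∀ u : EuclideanSpace ℝ (Fin n) → ℝ → ℝ,
      (∀ x t, ‖x‖ < R → t ∈ Icc (-R ^ 2) (0 : ℝ) → 0 ≤ u x t) →
      ContinuousOn (fun p : EuclideanSpace ℝ (Fin n) × ℝ => u p.1 p.2)
        {p | ‖p.1‖ < R ∧ p.2 ∈ Icc (-R ^ 2) (0 : ℝ)} →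
      (∀ t ∈ Ioo (-R ^ 2) (0 : ℝ), ContDiffOn ℝ 2 (fun x => u x t) (Metric.ball 0 R)) →
      (∀ x : EuclideanSpace ℝ (Fin n), ‖x‖ < R →
        ContDiffOn ℝ 1 (fun t => u x t) (Ioo (-R ^ 2) 0)) →
      (∀ x t, ‖x‖ < R → t ∈ Ioo (-R ^ 2) (0 : ℝ) →
        |deriv (fun s => u x s) t - spatialLaplacian u x t| ≤ M) →
      ∀ r : ℝ, 0 < r → r ≤ R →
        ∀ x t, ‖x‖ < r / Real.sqrt 3 →
          t ∈ Ioo (-(2 / 3) * r ^ 2) (-(1 / 3) * r ^ 2) →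
          u x t / r + ‖fderiv ℝ (fun z => u z t) x‖ ≤ C₃ * (u 0 0 / r + M * r) := by
  obtain ⟨p, C, hC, harnack⟩ := IsNonnegAlmostCaloric.harnack n
  refine ⟨C * 24 ^ p + n + 24 * n * (n + 1) * (C * 24 ^ p), by positivity, ?_⟩
  intro R M hR hM u hnonneg hcont hx2 ht1 heq r hr hrR x t hx ht
  have hr2 : 0 < r ^ 2 := by positivity
  have hrR2 : r ^ 2 ≤ R ^ 2 := pow_le_pow_left₀ hr.le hrR 2
  have hu : IsNonnegAlmostCaloric u r M := by
    refine ⟨fun x t hx ht => hnonneg x t (hx.trans_le hrR) ⟨by linarith [ht.1], ht.2⟩,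
      hcont.mono fun q hq => ⟨hq.1.trans_le hrR, by linarith [hq.2.1], hq.2.2⟩,
      fun x t hx ht => ?_, fun x t hx ht => ?_⟩
    · exact ((hx2 t ⟨by linarith [ht.1], ht.2⟩).differentiableOn (by norm_num)).differentiableAt
        (Metric.isOpen_ball.mem_nhds (by simpa using hx.trans_le hrR))
    · have htR : t ∈ Ioo (-R ^ 2) (0 : ℝ) := ⟨by linarith [ht.1], ht.2⟩
      have hxR := hx.trans_le hrR
      have hd : DifferentiableAt ℝ (fun s => u x s) t :=
        ((ht1 x hxR).differentiableOn (by norm_num)).differentiableAt (isOpen_Ioo.mem_nhds htR)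
      exact ⟨_, heq x t hxR htR, _, _, hd.hasDerivAt, fun i => hasSymmSecondDeriv_secondPartial
        Metric.isOpen_ball (hx2 t htR) (by simpa using hxR) i, rfl⟩
  have hu00 : 0 ≤ u 0 0 := hu.nonneg 0 0 (by simpa using hr) ⟨by linarith, le_rfl⟩
  have hx' : ‖x‖ ≤ 2 / 3 * r := by
    refine hx.le.trans ?_
    rw [div_le_iff₀ (by positivity)]
    have : 3 / 2 ≤ √3 := Real.le_sqrt_of_sq_le (by norm_num)
    nlinarith
  have hcyl : ∀ y s, (y, s) ∈ backwardCylinder x t (r / 24) → ‖y‖ < r ∧ s ∈ Ioo (-r ^ 2) (0 : ℝ) ∧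
      u y s ≤ C * 24 ^ p * (u 0 0 + M * r ^ 2) := by
    intro y s h
    obtain ⟨h1, h2, h3⟩ := mem_backwardCylinder.1 h
    have hy : ‖y‖ ≤ ‖x‖ + r / 24 := by
      have := norm_add_le (y - x) x
      rw [sub_add_cancel] at this
      linarith
    have hs : -(2 / 3) * r ^ 2 - r ^ 2 / 24 ≤ s := by nlinarith [ht.1]
    have hs' : s ≤ -(1 / 3) * r ^ 2 := h3.trans ht.2.le
    have hyr : ‖y‖ < r := by linarith
    have hsr : s ∈ Ioo (-r ^ 2) (0 : ℝ) := ⟨by linarith, by linarith⟩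
    refine ⟨hyr, hsr, ?_⟩
    have h4 := harnack u r M hr hM hu y s (by linarith) (by linarith) hs'
    have h5 : r / 24 ≤ min (3 / 4 * r - ‖y‖) ((s + 3 / 4 * r ^ 2) / r) :=
      le_min (by linarith) ((le_div_iff₀ hr).2 (by nlinarith))
    have h6 := hu.nonneg y s hyr (Ioo_subset_Icc_self hsr)
    have h7 : u y s * (r / 24) ^ p ≤ C * (u 0 0 + M * r ^ 2) * r ^ p :=
      le_trans (by gcongr) h4
    have h8 : C * (u 0 0 + M * r ^ 2) * r ^ p =
        C * 24 ^ p * (u 0 0 + M * r ^ 2) * (r / 24) ^ p := by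
      rw [div_pow]
      field_simp
    rw [h8] at h7
    exact le_of_mul_le_mul_right h7 (by positivity)
  have hxt := hcyl x t (mem_backwardCylinder.2 ⟨by simp; positivity, by nlinarith, le_rfl⟩)
  have hgrad := norm_fderiv_le_of_hasHeatValue (u := u) (x₀ := x) (t₀ := t) (d := r / 24)
    (N := C * 24 ^ p * (u 0 0 + M * r ^ 2)) (by positivity) hM
    (hu.continuousOn.mono fun q hq =>
      ⟨(hcyl q.1 q.2 hq).1, Ioo_subset_Icc_self (hcyl q.1 q.2 hq).2.1⟩)
    (fun y s h => ⟨hu.nonneg y s (hcyl y s h).1 (Ioo_subset_Icc_self (hcyl y s h).2.1),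
      (hcyl y s h).2.2⟩)
    (fun y s h _ => hu.heat y s (hcyl y s h).1 (hcyl y s h).2.1)
    (hu.differentiableAt x t hxt.1 hxt.2.1)
  have hval : u x t / r ≤ C * 24 ^ p * (u 0 0 / r + M * r) := by
    rw [div_le_iff₀ hr]
    refine hxt.2.2.trans (le_of_eq ?_)
    field_simp
  have hgrad' : n * (M * (r / 24) + (n + 1) * (C * 24 ^ p * (u 0 0 + M * r ^ 2)) / (r / 24)) =
      n * (M * r / 24) + 24 * n * (n + 1) * (C * 24 ^ p) * (u 0 0 / r + M * r) := by
    field_simp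
  have hsmall : n * (M * r / 24) ≤ n * (u 0 0 / r + M * r) := by
    have h1 : 0 ≤ u 0 0 / r := by positivity
    have h2 : 0 ≤ M * r := by positivity
    gcongr
    linarith
  rw [hgrad'] at hgrad
  linarith
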